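/- arXiv:1003.0006 — 2 statements merged into one kernel-verified Lean document; each statement's English description precedes it below -/
import Mathlib

section
/- Let E be a Polish space with its Borel σ-algebra, let ρ : E × E → [0,∞] be a lower semicontinuous metric on E (ρ(x,y) = 0 iff x = y, symmetric, triangle inequality), not necessarily the metric generating the topology of E, and let κ be a Markov kernel from E to E. Then sup_{x ≠ y} W_ρ(κ(x), κ(y)) / ρ(x,y) = sup { ‖κf‖_Lip : f : E → ℝ bounded Borel measurable with ‖f‖_Lip ≤ 1 }, as an equality in [0,∞]. -/
open MeasureTheory ProbabilityTheory

/-- The optimal coupling cost `W_ρ(μ, ν) = inf { ∫ ρ dπ : π a coupling of μ and ν }`. -/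
noncomputable def couplingCost {E : Type*} [MeasurableSpace E]
    (ρ : E × E → ENNReal) (μ ν : Measure E) : ENNReal :=
  ⨅ π ∈ {π : Measure (E × E) |
      IsProbabilityMeasure π ∧ π.map Prod.fst = μ ∧ π.map Prod.snd = ν},
    ∫⁻ p, ρ p ∂π

/-- The Lipschitz seminorm `‖g‖_Lip = sup_{x ≠ y} (g x − g y) / ρ(x,y)` with respect to the
cost `ρ`, valued in `[0,∞]`. -/
noncomputable def lipSeminorm {E : Type*} (ρ : E × E → ENNReal) (g : E → ℝ) : ENNReal :=
  ⨆ (x : E) (y : E) (_ : x ≠ y), ENNReal.ofReal (g x - g y) / ρ (x, y)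

theorem exists_measure_integral_eq_of_nonneg {X : Type*} [TopologicalSpace X] [T2Space X]
    [CompactSpace X] [MeasurableSpace X] [BorelSpace X] (L : C(X, ℝ) →ₗ[ℝ] ℝ)
    (hL : ∀ h : C(X, ℝ), (∀ x, 0 ≤ h x) → 0 ≤ L h) :
    ∃ m : Measure X, IsFiniteMeasure m ∧ ∀ h : C(X, ℝ), ∫ x, h x ∂m = L h := by
  let Λ : CompactlySupportedContinuousMap X ℝ →ₚ[ℝ] ℝ :=
  { toFun g := L g.toContinuousMap
    map_add' g g' := L.map_add g.toContinuousMap g'.toContinuousMap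
    map_smul' c g := L.map_smul c g.toContinuousMap
    monotone' g g' hgg' := by
      have h := hL (g'.toContinuousMap - g.toContinuousMap) fun x => sub_nonneg.2 (hgg' x)
      rw [map_sub] at h
      exact sub_nonneg.1 h }
  refine ⟨RealRMK.rieszMeasure Λ, inferInstance, fun h => ?_⟩
  exact RealRMK.integral_rieszMeasure Λ
    { toFun := h
      hasCompactSupport' := HasCompactSupport.of_compactSpace _ }

theorem LowerSemicontinuous.exists_continuousMap_iSup_eq {S X : Type*} [TopologicalSpace S]
    [Nonempty S] [PseudoMetricSpace X] {j : S → X} (hj : Topology.IsInducing j)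
    {ρ : S → ENNReal} (hρ : LowerSemicontinuous ρ) :
    ∃ c : ℕ → C(X, ℝ), (∀ n z, 0 ≤ c n z) ∧ (∀ z, Monotone fun n => c n z) ∧
      ∀ s, ⨆ n, ENNReal.ofReal (c n (j s)) = ρ s := by
  let F : ℕ → X → S → ℝ := fun n z w => (min (ρ w) n).toReal + n * dist z (j w)
  have hF0 : ∀ n z w, 0 ≤ F n z w := fun n z w => by positivity
  have hbdd : ∀ n z, BddBelow (Set.range (F n z)) := fun n z =>
    ⟨0, by rintro _ ⟨w, rfl⟩; exact hF0 n z w⟩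
  have hlip : ∀ n : ℕ, LipschitzWith (n : NNReal) fun z => ⨅ w, F n z w := fun n => by
    refine LipschitzWith.of_le_add_mul _ fun x y => ?_
    rw [← sub_le_iff_le_add]
    refine le_ciInf fun w => ?_
    rw [sub_le_iff_le_add]
    refine (ciInf_le (hbdd n x) w).trans ?_
    have h1 := dist_triangle x y (j w)
    have h2 := mul_le_mul_of_nonneg_left h1 (Nat.cast_nonneg (α := ℝ) n)
    simp only [F, NNReal.coe_natCast]
    linarith
  refine ⟨fun n => ⟨_, (hlip n).continuous⟩, fun n z => le_ciInf (hF0 n z), fun z n m hnm => ?_,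
    fun s => le_antisymm (iSup_le fun n => ?_) ?_⟩
  · refine ciInf_mono (hbdd n z) fun w => ?_
    have h : (n : ℝ) ≤ m := by exact_mod_cast hnm
    simp only [F]
    gcongr
    simp
  · refine (ENNReal.ofReal_le_ofReal (ciInf_le (hbdd n (j s)) s)).trans ?_
    simp only [F, dist_self, mul_zero, add_zero]
    exact ENNReal.ofReal_toReal_le.trans (min_le_left _ _)
  · refine le_of_forall_lt fun a ha => ?_
    obtain ⟨b, hab, hb⟩ := exists_between ha
    have hbtop : b ≠ ⊤ := (hb.trans_le le_top).ne
    obtain ⟨δ, hδ, hball⟩ := (Metric.nhds_basis_ball.comap j |>.mem_iff).1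
      (hj.nhds_eq_comap s ▸ hρ s b hb)
    obtain ⟨n, hn⟩ := exists_nat_ge (max b.toReal (b.toReal / δ))
    refine hab.trans_le ((?_ : b ≤ _).trans (le_iSup _ n))
    rw [← ENNReal.ofReal_toReal hbtop]
    refine ENNReal.ofReal_le_ofReal (le_ciInf fun w => ?_)
    rcases lt_or_ge (dist (j s) (j w)) δ with h | h
    · have hw : b < ρ w := hball (by simpa [dist_comm] using h)
      have : b ≤ min (ρ w) n := le_min hw.le <| by
        rw [← ENNReal.ofReal_toReal hbtop, ← ENNReal.ofReal_natCast]
        exact ENNReal.ofReal_le_ofReal ((le_max_left _ _).trans hn)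
      have h2 := ENNReal.toReal_mono (by simp) this
      have : (0:ℝ) ≤ n * dist (j s) (j w) := by positivity
      simp only [F]
      linarith
    · have h1 := (div_le_iff₀ hδ).1 ((le_max_right _ _).trans hn)
      have h2 := mul_le_mul_of_nonneg_left h (Nat.cast_nonneg (α := ℝ) n)
      have : 0 ≤ (min (ρ w) n).toReal := by positivity
      simp only [F]
      linarith

theorem exists_linearMap_le_of_dual_le {E X : Type*} [MeasurableSpace E] [TopologicalSpace X]
    [CompactSpace X] [MeasurableSpace X] [BorelSpace X] {j : E → X} (hj : Measurable j)
    (μ ν : Measure E) [IsProbabilityMeasure μ] [IsProbabilityMeasure ν]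
    (ρ : E × E → ENNReal) (D : ℝ)
    (hD : ∀ φ ψ : C(X, ℝ), (∀ x y, ENNReal.ofReal (φ (j x) + ψ (j y)) ≤ ρ (x, y)) →
      ∫ x, φ (j x) ∂μ + ∫ y, ψ (j y) ∂ν ≤ D) :
    ∃ L : C(X × X, ℝ) →ₗ[ℝ] ℝ, (∀ h : C(X × X, ℝ), (∀ z, 0 ≤ h z) → 0 ≤ L h) ∧
      (∀ φ : C(X, ℝ), L (φ.comp .fst) = ∫ x, φ (j x) ∂μ) ∧
      (∀ ψ : C(X, ℝ), L (ψ.comp .snd) = ∫ y, ψ (j y) ∂ν) ∧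
      ∀ c : C(X × X, ℝ), (∀ x y, ENNReal.ofReal (c (j x, j y)) ≤ ρ (x, y)) → L c ≤ D := by
  have hint : ∀ (m : Measure E) [IsProbabilityMeasure m] (φ : C(X, ℝ)),
      Integrable (fun x => φ (j x)) m := fun m _ φ =>
    Integrable.of_bound (φ.continuous.measurable.comp hj).aestronglyMeasurable ‖φ‖
      (ae_of_all _ fun x => φ.norm_coe_le_norm _)
  let I : C(X, ℝ) × C(X, ℝ) × ℝ →ₗ[ℝ] ℝ :=
  { toFun p := ∫ x, p.1 (j x) ∂μ + ∫ y, p.2.1 (j y) ∂ν + p.2.2 * D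
    map_add' p q := by
      simp only [Prod.fst_add, Prod.snd_add, ContinuousMap.add_apply]
      rw [integral_add (hint μ _) (hint μ _), integral_add (hint ν _) (hint ν _)]
      ring
    map_smul' a p := by
      simp only [Prod.smul_fst, Prod.smul_snd, ContinuousMap.smul_apply, smul_eq_mul,
        integral_const_mul, RingHom.id_apply]
      ring }
  let T : C(X, ℝ) × C(X, ℝ) × ℝ →ₗ[ℝ] C(X × X, ℝ) × ℝ :=
  { toFun p := (p.1.comp .fst + p.2.1.comp .snd, p.2.2)
    map_add' p q := by
      ext z
      · simp; ring
      · simp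
    map_smul' a p := by
      ext z
      · simp
      · simp }
  let s : PointedCone ℝ (C(X × X, ℝ) × ℝ) :=
  { carrier := {p | 0 ≤ p.2 ∧
      ∀ x y, ENNReal.ofReal (-p.1 (j x, j y)) ≤ ENNReal.ofReal p.2 * ρ (x, y)}
    zero_mem' := by simp
    add_mem' := by
      rintro p q ⟨hp, hp'⟩ ⟨hq, hq'⟩
      refine ⟨add_nonneg hp hq, fun x y => ?_⟩
      rw [Prod.snd_add, ENNReal.ofReal_add hp hq, add_mul]
      refine le_trans ?_ (add_le_add (hp' x y) (hq' x y))
      refine le_trans (le_of_eq ?_) ENNReal.ofReal_add_le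
      congr 1
      simp; ring
    smul_mem' := by
      rintro ⟨a, ha⟩ p ⟨hp, hp'⟩
      refine ⟨mul_nonneg ha hp, fun x y => ?_⟩
      have := mul_le_mul_right (hp' x y) (ENNReal.ofReal a)
      rw [← mul_assoc, ← ENNReal.ofReal_mul ha, ← ENNReal.ofReal_mul ha] at this
      refine le_trans (le_of_eq ?_) this
      congr 1
      simp }
  have key : ∀ p, T p ∈ s → 0 ≤ I p := by
    rintro ⟨φ, ψ, t⟩ ⟨ht : 0 ≤ t, h⟩
    change 0 ≤ ∫ x, φ (j x) ∂μ + ∫ y, ψ (j y) ∂ν + t * D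
    replace h : ∀ x y, ENNReal.ofReal (-(φ (j x) + ψ (j y))) ≤ ENNReal.ofReal t * ρ (x, y) := h
    rcases ht.eq_or_lt with rfl | ht
    · have h0 : ∀ z : E × E, 0 ≤ φ (j z.1) + ψ (j z.2) := fun z => by
        have := h z.1 z.2
        simp only [ENNReal.ofReal_zero, zero_mul, nonpos_iff_eq_zero,
          ENNReal.ofReal_eq_zero] at this
        linarith
      have := integral_nonneg (μ := μ.prod ν) (f := fun z => φ (j z.1) + ψ (j z.2)) h0
      rw [integral_add ((hint μ φ).comp_fst ν) ((hint ν ψ).comp_snd μ),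
        integral_fun_fst (fun x => φ (j x)), integral_fun_snd (fun x => ψ (j x))] at this
      simpa using this
    · have := hD (-(t⁻¹ • φ)) (-(t⁻¹ • ψ)) fun x y => by
        have h1 := mul_le_mul_right (h x y) (ENNReal.ofReal t⁻¹)
        rw [← mul_assoc, ← ENNReal.ofReal_mul (by positivity),
          ← ENNReal.ofReal_mul (by positivity), inv_mul_cancel₀ ht.ne', ENNReal.ofReal_one,
          one_mul] at h1
        refine le_trans (le_of_eq ?_) h1
        congr 1
        simp; ring
      simp only [ContinuousMap.neg_apply, ContinuousMap.smul_apply, smul_eq_mul, integral_neg,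
        integral_const_mul] at this
      have h2 := mul_le_mul_of_nonneg_left this ht.le
      have h3 : t * (-(t⁻¹ * ∫ x, φ (j x) ∂μ) + -(t⁻¹ * ∫ x, ψ (j x) ∂ν))
        = -(∫ x, φ (j x) ∂μ) - ∫ x, ψ (j x) ∂ν := by field_simp; ring
      linarith
  have hker : LinearMap.ker T ≤ LinearMap.ker I := fun p hp => by
    rw [LinearMap.mem_ker] at hp ⊢
    have h1 := key p (hp ▸ s.zero_mem)
    have h2 := key (-p) (by rw [map_neg, hp, neg_zero]; exact s.zero_mem)
    rw [map_neg] at h2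
    linarith
  obtain ⟨g, hg⟩ : ∃ g : LinearMap.range T →ₗ[ℝ] ℝ, ∀ p, g ⟨T p, p, rfl⟩ = I p := by
    refine ⟨(LinearMap.ker T).liftQ I hker ∘ₗ T.quotKerEquivRange.symm, fun p => ?_⟩
    have : T.quotKerEquivRange.symm ⟨T p, p, rfl⟩ = (LinearMap.ker T).mkQ p := by
      rw [LinearEquiv.symm_apply_eq]; rfl
    simp [this]
  obtain ⟨G, hG, hGs⟩ := riesz_extension s ⟨LinearMap.range T, g⟩
    (by rintro ⟨_, p, rfl⟩ hp; exact (key p hp).trans_eq (hg p).symm)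
    (fun y => by
      refine ⟨⟨T (ContinuousMap.const X ‖y.1‖, 0, |y.2|), _, rfl⟩, ?_, fun x x' => ?_⟩
      · change 0 ≤ |y.2| + y.2
        linarith [neg_abs_le y.2]
      · rw [ENNReal.ofReal_of_nonpos]
        · simp
        · have := y.1.neg_norm_le_apply (j x, j x')
          simp [T]
          linarith)
  have hGT : ∀ p, G (T p) = I p := fun p => (hG ⟨T p, p, rfl⟩).trans (hg p)
  refine ⟨G ∘ₗ LinearMap.inl ℝ _ _, fun h hh => hGs _ ⟨le_rfl, fun x y => ?_⟩, fun φ => ?_,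
    fun ψ => ?_, fun c hc => ?_⟩
  · simp [hh]
  · simpa [T, I] using hGT (φ, 0, 0)
  · simpa [T, I] using hGT (0, ψ, 0)
  · have h1 : 0 ≤ G (-c, 1) := hGs _ ⟨zero_le_one, fun x y => by simpa using hc x y⟩
    have h2 : G (0, 1) = D := by simpa [T, I] using hGT (0, 0, 1)
    have h3 : ((-c, 1) : C(X × X, ℝ) × ℝ) = (0, 1) - (c, 0) := by ext <;> simp
    rw [h3, map_sub, h2] at h1
    simpa using h1

theorem exists_coupling_lintegral_le_of_isEmbedding {E X : Type*} [TopologicalSpace E]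
    [PolishSpace E] [MeasurableSpace E] [BorelSpace E] [MetricSpace X] [CompactSpace X]
    [MeasurableSpace X] [BorelSpace X] {j : E → X} (hj : Topology.IsEmbedding j)
    (μ ν : Measure E) [IsProbabilityMeasure μ] [IsProbabilityMeasure ν]
    {ρ : E × E → ENNReal} (hρ : LowerSemicontinuous ρ) (D : ℝ)
    (hD : ∀ φ ψ : C(X, ℝ), (∀ x y, ENNReal.ofReal (φ (j x) + ψ (j y)) ≤ ρ (x, y)) →
      ∫ x, φ (j x) ∂μ + ∫ y, ψ (j y) ∂ν ≤ D) :
    ∃ π : Measure (E × E), IsProbabilityMeasure π ∧ π.map Prod.fst = μ ∧ π.map Prod.snd = ν ∧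
      ∫⁻ p, ρ p ∂π ≤ ENNReal.ofReal D := by
  have : Nonempty E := μ.nonempty_of_neZero
  have hjm : Measurable j := hj.continuous.measurable
  have hje : MeasurableEmbedding j := hjm.measurableEmbedding hj.injective
  obtain ⟨L, hLnn, hLφ, hLψ, hLc⟩ := exists_linearMap_le_of_dual_le hjm μ ν ρ D hD
  obtain ⟨m, hm, hmL⟩ := exists_measure_integral_eq_of_nonneg L hLnn
  have hfst : m.map Prod.fst = μ.map j := by
    have : IsProbabilityMeasure (μ.map j) := Measure.isProbabilityMeasure_map hjm.aemeasurable
    refine ext_of_forall_integral_eq_of_IsFiniteMeasure fun f => ?_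
    rw [integral_map measurable_fst.aemeasurable f.continuous.aestronglyMeasurable,
      integral_map hjm.aemeasurable f.continuous.aestronglyMeasurable]
    exact (hmL (f.toContinuousMap.comp .fst)).trans (hLφ f.toContinuousMap)
  have hsnd : m.map Prod.snd = ν.map j := by
    have : IsProbabilityMeasure (ν.map j) := Measure.isProbabilityMeasure_map hjm.aemeasurable
    refine ext_of_forall_integral_eq_of_IsFiniteMeasure fun f => ?_
    rw [integral_map measurable_snd.aemeasurable f.continuous.aestronglyMeasurable,
      integral_map hjm.aemeasurable f.continuous.aestronglyMeasurable]
    exact (hmL (f.toContinuousMap.comp .snd)).trans (hLψ f.toContinuousMap)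
  have hJe : MeasurableEmbedding (Prod.map j j) := hje.prodMap hje
  have hnull : ∀ (m' : Measure E), m'.map j (Set.range j)ᶜ = 0 := fun m' => by
    rw [hje.map_apply]; simp
  have hrange : ∀ᵐ z ∂m, z ∈ Set.range (Prod.map j j) := by
    have h1 : ∀ᵐ z ∂m, z.1 ∈ Set.range j :=
      ae_of_ae_map measurable_fst.aemeasurable (by rw [hfst]; exact hnull μ)
    have h2 : ∀ᵐ z ∂m, z.2 ∈ Set.range j :=
      ae_of_ae_map measurable_snd.aemeasurable (by rw [hsnd]; exact hnull ν)
    filter_upwards [h1, h2] with z hz1 hz2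
    rw [Set.range_prodMap]
    exact ⟨hz1, hz2⟩
  have hmap : (m.comap (Prod.map j j)).map (Prod.map j j) = m := by
    rw [hJe.map_comap, Measure.restrict_eq_self_of_ae_mem hrange]
  have h1 : (m.comap (Prod.map j j)).map Prod.fst = μ := by
    rw [← hje.comap_map ((m.comap (Prod.map j j)).map Prod.fst), Measure.map_map hjm measurable_fst,
      show j ∘ Prod.fst = Prod.fst ∘ Prod.map j j from rfl,
      ← Measure.map_map measurable_fst hJe.measurable, hmap, hfst, hje.comap_map]
  have h2 : (m.comap (Prod.map j j)).map Prod.snd = ν := by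
    rw [← hje.comap_map ((m.comap (Prod.map j j)).map Prod.snd), Measure.map_map hjm measurable_snd,
      show j ∘ Prod.snd = Prod.snd ∘ Prod.map j j from rfl,
      ← Measure.map_map measurable_snd hJe.measurable, hmap, hsnd, hje.comap_map]
  refine ⟨m.comap (Prod.map j j), ⟨?_⟩, h1, h2, ?_⟩
  · have := congrArg (fun m' : Measure E => m' Set.univ) h1
    simpa [Measure.map_apply measurable_fst MeasurableSet.univ] using this
  · obtain ⟨c, hc0, hcm, hcρ⟩ :=
      hρ.exists_continuousMap_iSup_eq (hj.prodMap hj).isInducing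
    have hmeas : ∀ n, Measurable fun z => ENNReal.ofReal (c n z) := fun n =>
      (c n).continuous.measurable.ennreal_ofReal
    simp_rw [← hcρ]
    rw [lintegral_iSup (f := fun n p => ENNReal.ofReal (c n (Prod.map j j p)))
      (fun n => (hmeas n).comp hJe.measurable)
      fun n k hnk p => ENNReal.ofReal_le_ofReal (hcm _ hnk)]
    refine iSup_le fun n => ?_
    rw [← lintegral_map (hmeas n) hJe.measurable, hmap,
      ← ofReal_integral_eq_lintegral_ofReal _ (ae_of_all _ (hc0 n)), hmL]
    · exact ENNReal.ofReal_le_ofReal <| hLc _ fun x y =>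
        (le_iSup (fun n => ENNReal.ofReal (c n (j x, j y))) n).trans_eq (hcρ (x, y))
    · exact Integrable.of_bound (c n).continuous.aestronglyMeasurable ‖c n‖
        (ae_of_all _ (c n).norm_coe_le_norm)

theorem LowerSemicontinuous.iInf_isCompact {α β : Type*} [TopologicalSpace α] [TopologicalSpace β]
    {K : Set β} (hK : IsCompact K) (hKne : K.Nonempty) {g : α × β → ℝ}
    (hg : LowerSemicontinuous g) : LowerSemicontinuous fun x => ⨅ y : K, g (x, y) := by
  have : CompactSpace K := isCompact_iff_compactSpace.1 hK
  have : Nonempty K := hKne.to_subtype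
  have hg' : LowerSemicontinuous fun p : α × K => g (p.1, p.2) :=
    hg.comp (g := fun p : α × K => (p.1, (p.2 : β))) (by fun_prop)
  rw [lowerSemicontinuous_iff_isClosed_preimage]
  intro a
  convert isClosedMap_fst_of_compactSpace _ (hg'.isClosed_preimage a) using 1
  ext x
  have hx : LowerSemicontinuous fun y : K => g (x, y) :=
    hg'.comp (g := fun y : K => (x, y)) (by fun_prop)
  obtain ⟨y₀, -, hy₀⟩ := (hx.lowerSemicontinuousOn Set.univ).exists_isMinOn Set.univ_nonempty
    isCompact_univ
  have hmin : ∀ y : K, g (x, y₀) ≤ g (x, y) := fun y => hy₀ (Set.mem_univ y)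
  constructor
  · exact fun h => ⟨(x, y₀), (le_ciInf hmin).trans h, rfl⟩
  · rintro ⟨⟨x, y⟩, hy, rfl⟩
    exact (ciInf_le ⟨_, by rintro _ ⟨z, rfl⟩; exact hmin z⟩ y).trans hy

/-- A dual pair of potentials for a bounded lower semicontinuous pseudometric is dominated, up to
an arbitrarily small error, by a single bounded Borel function which is `1`-Lipschitz. -/
theorem exists_lipschitz_potential {E : Type*} [TopologicalSpace E]
    [PolishSpace E] [MeasurableSpace E] [BorelSpace E]
    (μ ν : Measure E) [IsProbabilityMeasure μ] [IsProbabilityMeasure ν]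
    {r : E × E → ℝ} (hr : LowerSemicontinuous r) {C : ℝ} (hr0 : ∀ p, 0 ≤ r p)
    (hrC : ∀ p, r p ≤ 2 * C) (hr_self : ∀ x, r (x, x) = 0)
    (hr_tri : ∀ x y z, r (x, y) ≤ r (x, z) + r (z, y))
    {φ ψ : E → ℝ} (hφ : Continuous φ) (hψ : Continuous ψ) (hφC : ∀ x, |φ x| ≤ C)
    (hψC : ∀ x, |ψ x| ≤ C) (h : ∀ x y, φ x + ψ y ≤ r (x, y)) {ε : ℝ} (hε : 0 < ε) :
    ∃ f : E → ℝ, Measurable f ∧ (∃ B, ∀ x, |f x| ≤ B) ∧ (∀ x y, f x - f y ≤ r (x, y)) ∧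
      ∫ x, φ x ∂μ + ∫ y, ψ y ∂ν ≤ ∫ x, f x ∂μ - ∫ y, f y ∂ν + ε := by
  obtain ⟨x₀⟩ : Nonempty E := μ.nonempty_of_neZero
  have hC : 0 ≤ C := (abs_nonneg _).trans (hφC x₀)
  obtain ⟨K₀, -, hK₀, hνK₀⟩ := MeasurableSet.univ.exists_isCompact_sdiff_lt (μ := ν)
    (measure_ne_top _ _) (ε := ENNReal.ofReal (ε / (4 * C + 1)))
    (by simp only [ne_eq, ENNReal.ofReal_eq_zero, not_le]; positivity)
  obtain ⟨K, hK, hx₀K, hνK⟩ : ∃ K : Set E, IsCompact K ∧ x₀ ∈ K ∧ ν.real Kᶜ ≤ ε / (4 * C + 1) := by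
    refine ⟨insert x₀ K₀, hK₀.insert x₀, Set.mem_insert _ _,
      ENNReal.toReal_le_of_le_ofReal (by positivity) ((measure_mono ?_).trans hνK₀.le)⟩
    intro x hx
    exact ⟨trivial, fun h => hx (Set.mem_insert_of_mem _ h)⟩
  have : Nonempty K := ⟨⟨x₀, hx₀K⟩⟩
  let f : E → ℝ := fun x => ⨅ y : K, (r (x, y) - ψ y)
  have hlow : ∀ x (y : K), -C ≤ r (x, y) - ψ y := fun x y => by
    linarith [hr0 (x, y), (abs_le.1 (hψC y)).2]
  have hbdd : ∀ x, BddBelow (Set.range fun y : K => r (x, y) - ψ y) := fun x =>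
    ⟨-C, by rintro _ ⟨y, rfl⟩; exact hlow x y⟩
  have hf_le : ∀ x (y : E), y ∈ K → f x ≤ r (x, y) - ψ y := fun x y hy =>
    ciInf_le (hbdd x) ⟨y, hy⟩
  have hfm : Measurable f := by
    have hψ' : LowerSemicontinuous fun p : E × E => -ψ p.2 :=
      (hψ.comp continuous_snd).neg.lowerSemicontinuous
    have := hr.add hψ'
    simp only [← sub_eq_add_neg] at this
    exact (this.iInf_isCompact hK ⟨x₀, hx₀K⟩).measurable
  have hfC : ∀ x, |f x| ≤ 3 * C := fun x => abs_le.2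
    ⟨by linarith [le_ciInf (hlow x)],
      by linarith [hf_le x x₀ hx₀K, hrC (x, x₀), (abs_le.1 (hψC x₀)).1]⟩
  have hint : ∀ (m : Measure E) [IsProbabilityMeasure m] (g : E → ℝ) (B : ℝ), Measurable g →
      (∀ x, |g x| ≤ B) → Integrable g m := fun m _ g B hg hB =>
    Integrable.of_bound hg.aestronglyMeasurable B (ae_of_all _ hB)
  refine ⟨f, hfm, ⟨_, hfC⟩, fun x y => ?_, ?_⟩
  · rw [sub_le_comm]
    refine le_ciInf fun z => ?_
    linarith [hf_le x z z.2, hr_tri x z y]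
  · have h1 : ∫ x, φ x ∂μ ≤ ∫ x, f x ∂μ := by
      refine integral_mono (hint μ _ _ hφ.measurable hφC) (hint μ _ _ hfm hfC) fun x => ?_
      exact le_ciInf fun y => by linarith [h x y]
    have h2 : ∫ y, (ψ y + f y) ∂ν ≤ ∫ y, Kᶜ.indicator (fun _ => 4 * C) y ∂ν := by
      refine integral_mono ((hint ν _ _ hψ.measurable hψC).add (hint ν _ _ hfm hfC))
        ((integrable_const _).indicator hK.measurableSet.compl) fun y => ?_
      by_cases hy : y ∈ K
      · have := hf_le y y hy
        rw [hr_self] at this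
        simp only [Set.mem_compl_iff, hy, not_true_eq_false, not_false_eq_true,
          Set.indicator_of_notMem]
        linarith
      · simp only [Set.mem_compl_iff, hy, not_false_eq_true, Set.indicator_of_mem]
        linarith [(abs_le.1 (hψC y)).2, (abs_le.1 (hfC y)).2]
    rw [integral_add (hint ν _ _ hψ.measurable hψC) (hint ν _ _ hfm hfC),
      integral_indicator_const _ hK.measurableSet.compl, smul_eq_mul] at h2
    have h3 : ν.real Kᶜ * (4 * C) ≤ ε := by
      rw [le_div_iff₀ (by positivity)] at hνK
      nlinarith [measureReal_nonneg (μ := ν) (s := Kᶜ)]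
    linarith

theorem le_lipSeminorm {E : Type*} (ρ : E × E → ENNReal) (g : E → ℝ) {x y : E} (hxy : x ≠ y) :
    ENNReal.ofReal (g x - g y) / ρ (x, y) ≤ lipSeminorm ρ g :=
  le_iSup₂_of_le x y (le_iSup_of_le hxy le_rfl)

theorem ofReal_sub_le_of_lipSeminorm_le_one {E : Type*} {ρ : E × E → ENNReal}
    (hρ_eq : ∀ x y : E, ρ (x, y) = 0 ↔ x = y) {f : E → ℝ} (hf : lipSeminorm ρ f ≤ 1) (x y : E) :
    ENNReal.ofReal (f x - f y) ≤ ρ (x, y) := by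
  rcases eq_or_ne x y with rfl | hxy
  · simp
  · have h : ENNReal.ofReal (f x - f y) / ρ (x, y) ≤ 1 :=
      (le_lipSeminorm ρ f hxy).trans hf
    by_cases htop : ρ (x, y) = ⊤
    · simp [htop]
    · simpa using (ENNReal.div_le_iff (mt (hρ_eq x y).1 hxy) htop).1 h

theorem ofReal_integral_sub_le_couplingCost {E : Type*} [MeasurableSpace E]
    {ρ : E × E → ENNReal} {μ ν : Measure E} {f : E → ℝ} (hf : Measurable f)
    {C : ℝ} (hC : ∀ x, |f x| ≤ C) (hfρ : ∀ x y, ENNReal.ofReal (f x - f y) ≤ ρ (x, y)) :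
    ENNReal.ofReal (∫ x, f x ∂μ - ∫ y, f y ∂ν) ≤ couplingCost ρ μ ν := by
  refine le_iInf₂ fun π ⟨hπ, h1, h2⟩ => ?_
  have hi1 : Integrable (fun p : E × E => f p.1) π :=
    Integrable.of_bound (hf.comp measurable_fst).aestronglyMeasurable C (ae_of_all _ fun p => hC _)
  have hi2 : Integrable (fun p : E × E => f p.2) π :=
    Integrable.of_bound (hf.comp measurable_snd).aestronglyMeasurable C (ae_of_all _ fun p => hC _)
  rw [← h1, ← h2, integral_map measurable_fst.aemeasurable hf.aestronglyMeasurable,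
    integral_map measurable_snd.aemeasurable hf.aestronglyMeasurable, ← integral_sub hi1 hi2]
  refine (ENNReal.ofReal_le_ofReal (integral_mono (hi1.sub hi2)
    ((hi1.sub hi2).real_toNNReal) fun p => Real.le_coe_toNNReal _)).trans ?_
  rw [ofReal_integral_eq_lintegral_ofReal ((hi1.sub hi2).real_toNNReal)
    (ae_of_all _ fun p => NNReal.coe_nonneg _)]
  exact lintegral_mono fun p => by simpa using hfρ p.1 p.2

/-- **Kantorovich–Rubinstein duality** for a lower semicontinuous extended metric `ρ`: the nontrivial
inequality. -/
theorem couplingCost_le_of_forall_lipSeminorm_le_one {E : Type*} [TopologicalSpace E]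
    [PolishSpace E] [MeasurableSpace E] [BorelSpace E]
    {ρ : E × E → ENNReal} (hρ_lsc : LowerSemicontinuous ρ)
    (hρ_eq : ∀ x y : E, ρ (x, y) = 0 ↔ x = y)
    (hρ_tri : ∀ x y z : E, ρ (x, y) ≤ ρ (x, z) + ρ (z, y))
    (μ ν : Measure E) [IsProbabilityMeasure μ] [IsProbabilityMeasure ν] (D : ℝ)
    (hD : ∀ f : E → ℝ, Measurable f → (∃ C : ℝ, ∀ x, |f x| ≤ C) → lipSeminorm ρ f ≤ 1 →
      ∫ x, f x ∂μ - ∫ y, f y ∂ν ≤ D) :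
    couplingCost ρ μ ν ≤ ENNReal.ofReal D := by
  let _ := TopologicalSpace.upgradeIsCompletelyMetrizable E
  let _ : MetricSpace (ℕ → unitInterval) := TopologicalSpace.metrizableSpaceMetric _
  obtain ⟨j, hj⟩ := Metric.PiNatEmbed.exists_embedding_to_hilbert_cube (X := E)
  suffices h : ∀ φ ψ : C(ℕ → unitInterval, ℝ),
      (∀ x y, ENNReal.ofReal (φ (j x) + ψ (j y)) ≤ ρ (x, y)) →
        ∫ x, φ (j x) ∂μ + ∫ y, ψ (j y) ∂ν ≤ D by
    obtain ⟨π, hπ, h1, h2, hπD⟩ :=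
      exists_coupling_lintegral_le_of_isEmbedding hj μ ν hρ_lsc D h
    exact (iInf₂_le π ⟨hπ, h1, h2⟩).trans hπD
  intro φ ψ hφψ
  refine le_of_forall_pos_le_add fun ε hε => ?_
  let C : ℝ := ‖φ‖ + ‖ψ‖
  have hC : 0 ≤ C := by positivity
  let r : E × E → ℝ := fun p => (min (ρ p) (ENNReal.ofReal (2 * C))).toReal
  have hfin : ∀ p, min (ρ p) (ENNReal.ofReal (2 * C)) ≠ ⊤ := fun p =>
    (min_lt_of_right_lt ENNReal.ofReal_lt_top).ne
  have hφC : ∀ x, |φ x| ≤ C := fun x =>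
    (φ.norm_coe_le_norm x).trans (le_add_of_nonneg_right (norm_nonneg _))
  have hψC : ∀ x, |ψ x| ≤ C := fun x =>
    (ψ.norm_coe_le_norm x).trans (le_add_of_nonneg_left (norm_nonneg _))
  have hr : LowerSemicontinuous r := by
    intro p a ha
    rcases lt_or_ge a 0 with h0 | h0
    · exact Filter.Eventually.of_forall fun q => h0.trans_le ENNReal.toReal_nonneg
    · have ha' := (ENNReal.ofReal_lt_iff_lt_toReal h0 (hfin p)).2 ha
      rw [lt_min_iff] at ha'
      filter_upwards [hρ_lsc p _ ha'.1] with q hq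
      exact (ENNReal.ofReal_lt_iff_lt_toReal h0 (hfin q)).1 (lt_min hq ha'.2)
  have hr_tri : ∀ x y z, r (x, y) ≤ r (x, z) + r (z, y) := by
    intro x y z
    rw [← ENNReal.toReal_add (hfin _) (hfin _)]
    refine ENNReal.toReal_mono (ENNReal.add_ne_top.2 ⟨hfin _, hfin _⟩) ?_
    rcases le_total (ρ (x, z)) (ENNReal.ofReal (2 * C)) with h | h
    · rcases le_total (ρ (z, y)) (ENNReal.ofReal (2 * C)) with h' | h'
      · rw [min_eq_left h, min_eq_left h']
        exact (min_le_left _ _).trans (hρ_tri x y z)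
      · rw [min_eq_right h']
        exact (min_le_right _ _).trans le_add_self
    · rw [min_eq_right h]
      exact (min_le_right _ _).trans le_self_add
  have hr_le : ∀ x y, φ (j x) + ψ (j y) ≤ r (x, y) := by
    intro x y
    refine (ENNReal.ofReal_le_iff_le_toReal (hfin _)).1 (le_min (hφψ x y) ?_)
    refine ENNReal.ofReal_le_ofReal ?_
    have h1 := (abs_le.1 (hφC (j x))).2
    have h2 := (abs_le.1 (hψC (j y))).2
    linarith
  obtain ⟨f, hfm, hfb, hfr, hfi⟩ := exists_lipschitz_potential μ ν (r := r) (C := C)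
    (φ := φ ∘ j) (ψ := ψ ∘ j) hr (fun p => ENNReal.toReal_nonneg)
    (fun p => ENNReal.toReal_le_of_le_ofReal (by positivity) (min_le_right _ _))
    (fun x => by simp [r, (hρ_eq x x).2 rfl]) hr_tri (φ.continuous.comp hj.continuous)
    (ψ.continuous.comp hj.continuous) (fun x => hφC _) (fun x => hψC _) hr_le hε
  refine hfi.trans (add_le_add_left (hD f hfm hfb ?_) _)
  refine iSup₂_le fun x y => iSup_le fun hxy => ENNReal.div_le_of_le_mul ?_
  rw [one_mul]
  exact (ENNReal.ofReal_le_ofReal (hfr x y)).trans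
    (ENNReal.ofReal_toReal_le.trans (min_le_left _ _))

theorem stmt_7 {E : Type*} [TopologicalSpace E] [PolishSpace E]
    [MeasurableSpace E] [BorelSpace E]
    (ρ : E × E → ENNReal) (hρ_lsc : LowerSemicontinuous ρ)
    (hρ_eq : ∀ x y : E, ρ (x, y) = 0 ↔ x = y)
    (hρ_symm : ∀ x y : E, ρ (x, y) = ρ (y, x))
    (hρ_tri : ∀ x y z : E, ρ (x, y) ≤ ρ (x, z) + ρ (z, y))
    (κ : Kernel E E) [IsMarkovKernel κ] :
    (⨆ (x : E) (y : E) (_ : x ≠ y), couplingCost ρ (κ x) (κ y) / ρ (x, y)) =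
      ⨆ f ∈ {f : E → ℝ | Measurable f ∧ (∃ C : ℝ, ∀ x, |f x| ≤ C) ∧
          lipSeminorm ρ f ≤ 1},
        lipSeminorm ρ (fun x => ∫ z, f z ∂(κ x)) := by
  refine le_antisymm (iSup₂_le fun x y => iSup_le fun hxy => ?_)
    (iSup₂_le fun f ⟨hfm, ⟨C, hC⟩, hf⟩ => iSup₂_mono fun x y => iSup_mono fun hxy => ?_)
  · set M := ⨆ f ∈ {f : E → ℝ | Measurable f ∧ (∃ C : ℝ, ∀ x, |f x| ≤ C) ∧
      lipSeminorm ρ f ≤ 1}, lipSeminorm ρ (fun x => ∫ z, f z ∂(κ x))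
    by_cases hMtop : M = ⊤
    · simp [hMtop]
    by_cases hρtop : ρ (x, y) = ⊤
    · simp [hρtop]
    have hfin : M * ρ (x, y) ≠ ⊤ := ENNReal.mul_ne_top hMtop hρtop
    refine ENNReal.div_le_of_le_mul ?_
    rw [← ENNReal.ofReal_toReal hfin]
    refine couplingCost_le_of_forall_lipSeminorm_le_one hρ_lsc hρ_eq hρ_tri _ _ _
      fun f hfm hfb hf => ?_
    refine (ENNReal.ofReal_le_iff_le_toReal hfin).1 ?_
    rw [← ENNReal.div_le_iff (mt (hρ_eq x y).1 hxy) hρtop]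
    calc ENNReal.ofReal (∫ z, f z ∂κ x - ∫ z, f z ∂κ y) / ρ (x, y)
        ≤ lipSeminorm ρ (fun x => ∫ z, f z ∂(κ x)) :=
          le_lipSeminorm ρ (fun x => ∫ z, f z ∂(κ x)) hxy
      _ ≤ M := le_iSup₂_of_le f ⟨hfm, hfb, hf⟩ le_rfl
  · exact ENNReal.div_le_div_right (ofReal_integral_sub_le_couplingCost hfm hC
      (ofReal_sub_le_of_lipSeminorm_le_one hρ_eq hf)) _
end

section
/- Let E be a Polish space with its Borel σ-algebra, let ρ : E × E → [0,∞] be a lower semicontinuous metric on E, and let (κ_t)_{t≥0} be a Markov semigroup on E that acts as a contraction for ρ. Assume t ↦ W_ρ(κ_t(x), κ_t(y)) is Borel measurable for each x, y, and define the generalized coupling time h(x,y) := ∫_0^∞ W_ρ(κ_t(x), κ_t(y)) dt. Suppose there is M > 0 with h(x,y) ≤ M·ρ(x,y) for all x, y ∈ E. Then for every α > 1 and every t ≥ M·α, one has W_ρ(κ_t(x), κ_t(y)) ≤ ρ(x,y)/α for all x, y ∈ E. -/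
open MeasureTheory ProbabilityTheory

open Filter Topology

/-- A form of the Hahn-Banach theorem: a convex cone in `V × ℝ` that projects onto `V` and contains
no `(0, r)` with `r < 0` lies above the graph of a linear functional. -/
theorem exists_linearMap_le_of_convexCone {V : Type*} [AddCommGroup V] [Module ℝ V]
    (P : ConvexCone ℝ (V × ℝ)) (hne : ∀ v, ∃ r, (v, r) ∈ P)
    (hzero : ∀ r, ((0 : V), r) ∈ P → 0 ≤ r) :
    ∃ Λ : V →ₗ[ℝ] ℝ, ∀ v r, (v, r) ∈ P → Λ v ≤ r := by
  have hbdd : ∀ v, BddBelow {r | (v, r) ∈ P} := by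
    intro v
    obtain ⟨r', hr'⟩ := hne (-v)
    refine ⟨-r', fun r hr => ?_⟩
    have h := hzero (r + r') (by simpa using P.add_mem hr hr')
    linarith
  have hsmul : ∀ c : ℝ, 0 < c → ∀ v, sInf {r | (c • v, r) ∈ P} ≤ c * sInf {r | (v, r) ∈ P} := by
    intro c hc v
    rw [← div_le_iff₀' hc]
    refine le_csInf (hne v) fun r hr => ?_
    rw [div_le_iff₀' hc]
    exact csInf_le (hbdd _) (P.smul_mem hc hr)
  have hhom : ∀ c : ℝ, 0 < c → ∀ v,
      sInf {r | (c • v, r) ∈ P} = c * sInf {r | (v, r) ∈ P} := by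
    intro c hc v
    refine le_antisymm (hsmul c hc v) ?_
    have h := hsmul c⁻¹ (inv_pos.2 hc) (c • v)
    rw [inv_smul_smul₀ hc.ne'] at h
    calc c * sInf {r | (v, r) ∈ P} ≤ c * (c⁻¹ * sInf {r | (c • v, r) ∈ P}) := by gcongr
      _ = _ := mul_inv_cancel_left₀ hc.ne' _
  have hadd : ∀ v w, sInf {r | (v + w, r) ∈ P} ≤ sInf {r | (v, r) ∈ P} + sInf {r | (w, r) ∈ P} := by
    intro v w
    rw [← sub_le_iff_le_add]
    refine le_csInf (hne v) fun r hr => ?_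
    rw [sub_le_comm]
    refine le_csInf (hne w) fun r' hr' => ?_
    rw [sub_le_iff_le_add']
    exact csInf_le (hbdd _) (P.add_mem hr hr')
  have hbot : ∀ x : (⊥ : V →ₗ.[ℝ] ℝ).domain,
      (⊥ : V →ₗ.[ℝ] ℝ) x ≤ sInf {r | ((x : V), r) ∈ P} := by
    rintro ⟨x, hx⟩
    obtain rfl : x = 0 := (Submodule.mem_bot ℝ).1 hx
    have h : (⊥ : V →ₗ.[ℝ] ℝ) ⟨0, hx⟩ = 0 := LinearPMap.map_zero _
    rw [h]
    exact le_csInf (hne 0) hzero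
  obtain ⟨Λ, -, hΛ⟩ := exists_extension_of_le_sublinear (⊥ : V →ₗ.[ℝ] ℝ)
    (fun v => sInf {r | (v, r) ∈ P}) hhom hadd hbot
  exact ⟨Λ, fun v r hr => (hΛ v).trans (csInf_le (hbdd v) hr)⟩

/-- A positive linear functional on continuous functions on a compact space is the integral
against a finite measure. -/
theorem exists_isFiniteMeasure_integral_eq {X : Type*} [TopologicalSpace X] [T2Space X]
    [CompactSpace X] [MeasurableSpace X] [BorelSpace X] (Λ : C(X, ℝ) →ₗ[ℝ] ℝ)
    (hΛ : ∀ f, 0 ≤ f → 0 ≤ Λ f) :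
    ∃ π : Measure X, IsFiniteMeasure π ∧ ∀ f : C(X, ℝ), ∫ x, f x ∂π = Λ f := by
  let T : CompactlySupportedContinuousMap X ℝ →ₚ[ℝ] ℝ := PositiveLinearMap.mk₀
    { toFun := fun f => Λ f.toContinuousMap
      map_add' := fun f g => Λ.map_add f.toContinuousMap g.toContinuousMap
      map_smul' := fun c f => Λ.map_smul c f.toContinuousMap }
    (fun f hf => hΛ _ hf)
  exact ⟨RealRMK.rieszMeasure T, inferInstance, fun f => RealRMK.integral_rieszMeasure T
    ⟨f, HasCompactSupport.of_compactSpace _⟩⟩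

/-- Kantorovich duality on a compact space, in functional form: there is a coupling bounding the
integrals of all continuous functions below the cost by the value of the dual problem. -/
theorem exists_coupling_integral_le {K : Type*} [TopologicalSpace K] [CompactSpace K]
    [T2Space K] [SecondCountableTopology K] [MeasurableSpace K] [BorelSpace K]
    (μ ν : Measure K) [IsProbabilityMeasure μ] [IsProbabilityMeasure ν]
    (c : K × K → ENNReal) (D : ℝ)
    (hdual : ∀ φ ψ : C(K, ℝ), (∀ a b, ENNReal.ofReal (φ a + ψ b) ≤ c (a, b)) →
      ∫ a, φ a ∂μ + ∫ b, ψ b ∂ν ≤ D) :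
    ∃ π : Measure (K × K), IsProbabilityMeasure π ∧ π.map Prod.fst = μ ∧ π.map Prod.snd = ν ∧
      ∀ g : C(K × K, ℝ), (∀ p, ENNReal.ofReal (g p) ≤ c p) → ∫ p, g p ∂π ≤ D := by
  have hint : ∀ (m : Measure K) [IsProbabilityMeasure m] (φ : C(K, ℝ)), Integrable φ m :=
    fun m _ φ => φ.continuous.integrable_of_hasCompactSupport (HasCompactSupport.of_compactSpace _)
  let P : ConvexCone ℝ (C(K × K, ℝ) × ℝ) :=
    { carrier := {q | ∃ (φ ψ : C(K, ℝ)) (t : ℝ), 0 < t ∧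
        (∀ a b, ENNReal.ofReal (q.1 (a, b) - φ a - ψ b) ≤ ENNReal.ofReal t * c (a, b)) ∧
        q.2 = ∫ a, φ a ∂μ + ∫ b, ψ b ∂ν + t * D}
      smul_mem' := by
        rintro s hs ⟨g, r⟩ ⟨φ, ψ, t, ht, h, hr⟩
        refine ⟨s • φ, s • ψ, s * t, mul_pos hs ht, fun a b => ?_, ?_⟩
        · have e : (s • g) (a, b) - (s • φ) a - (s • ψ) b = s * (g (a, b) - φ a - ψ b) := by
            simp only [ContinuousMap.smul_apply, smul_eq_mul]; ring
          simp only [Prod.smul_fst]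
          rw [e, ENNReal.ofReal_mul hs.le, ENNReal.ofReal_mul hs.le, mul_assoc]
          gcongr
          exact h a b
        · simp only [Prod.smul_snd, ContinuousMap.smul_apply, smul_eq_mul, integral_const_mul]
          simp only at hr
          rw [hr]; ring
      add_mem' := by
        rintro ⟨g, r⟩ ⟨φ, ψ, t, ht, h, hr⟩ ⟨g', r'⟩ ⟨φ', ψ', t', ht', h', hr'⟩
        refine ⟨φ + φ', ψ + ψ', t + t', add_pos ht ht', fun a b => ?_, ?_⟩
        · have e : (g + g') (a, b) - (φ + φ') a - (ψ + ψ') b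
              = (g (a, b) - φ a - ψ b) + (g' (a, b) - φ' a - ψ' b) := by
            simp only [ContinuousMap.add_apply]; ring
          simp only [Prod.mk_add_mk]
          rw [e, ENNReal.ofReal_add ht.le ht'.le, add_mul]
          exact ENNReal.ofReal_add_le.trans (add_le_add (h a b) (h' a b))
        · simp only [Prod.mk_add_mk, ContinuousMap.add_apply]
          simp only at hr hr'
          rw [integral_add (hint μ φ) (hint μ φ'), integral_add (hint ν ψ) (hint ν ψ'), hr, hr']
          ring }
  have hne : ∀ g, ∃ r, (g, r) ∈ P := by
    intro g
    refine ⟨_, ContinuousMap.const K ‖g‖, 0, 1, one_pos, fun a b => ?_, rfl⟩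
    have h : g (a, b) ≤ ‖g‖ := (le_abs_self _).trans (g.norm_coe_le_norm (a, b))
    rw [ENNReal.ofReal_of_nonpos (by simpa using h)]
    exact zero_le
  have hzero : ∀ r, ((0 : C(K × K, ℝ)), r) ∈ P → 0 ≤ r := by
    rintro r ⟨φ, ψ, t, ht, h, hr⟩
    have key := hdual (-(t⁻¹ • φ)) (-(t⁻¹ • ψ)) fun a b => by
      have e : (-(t⁻¹ • φ)) a + (-(t⁻¹ • ψ)) b = t⁻¹ * ((0 : C(K × K, ℝ)) (a, b) - φ a - ψ b) := by
        simp only [ContinuousMap.neg_apply, ContinuousMap.smul_apply, smul_eq_mul,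
          ContinuousMap.zero_apply]
        ring
      rw [e, ENNReal.ofReal_mul (inv_pos.2 ht).le]
      calc _ ≤ ENNReal.ofReal t⁻¹ * (ENNReal.ofReal t * c (a, b)) := by gcongr; exact h a b
        _ = c (a, b) := by
          rw [← mul_assoc, ← ENNReal.ofReal_mul (inv_pos.2 ht).le, inv_mul_cancel₀ ht.ne',
            ENNReal.ofReal_one, one_mul]
    simp only [ContinuousMap.neg_apply, ContinuousMap.smul_apply, smul_eq_mul, integral_neg,
      integral_const_mul] at key
    simp only at hr
    have h2 := mul_le_mul_of_nonneg_left key ht.le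
    have h3 : t * (-(t⁻¹ * ∫ a, φ a ∂μ) + -(t⁻¹ * ∫ b, ψ b ∂ν))
        = -(∫ a, φ a ∂μ + ∫ b, ψ b ∂ν) := by
      field_simp
      ring
    linarith
  obtain ⟨Λ, hΛ⟩ := exists_linearMap_le_of_convexCone P hne hzero
  have hle : ∀ (g : C(K × K, ℝ)) (φ ψ : C(K, ℝ)), (∀ a b, g (a, b) ≤ φ a + ψ b) →
      Λ g ≤ ∫ a, φ a ∂μ + ∫ b, ψ b ∂ν := by
    intro g φ ψ h
    have h1 : ∀ t : ℝ, 0 < t → Λ g ≤ ∫ a, φ a ∂μ + ∫ b, ψ b ∂ν + t * D := by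
      intro t ht
      refine hΛ g _ ⟨φ, ψ, t, ht, fun a b => ?_, rfl⟩
      rw [ENNReal.ofReal_of_nonpos (by linarith [h a b])]
      exact zero_le
    have h2 : Tendsto (fun t : ℝ => ∫ a, φ a ∂μ + ∫ b, ψ b ∂ν + t * D) (𝓝[>] 0)
        (𝓝 (∫ a, φ a ∂μ + ∫ b, ψ b ∂ν + 0 * D)) :=
      (Continuous.tendsto (by fun_prop) 0).mono_left nhdsWithin_le_nhds
    rw [zero_mul, add_zero] at h2
    exact ge_of_tendsto h2 (eventually_nhdsWithin_of_forall h1)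
  obtain ⟨π, hπ, hπΛ⟩ := exists_isFiniteMeasure_integral_eq Λ fun f hf => by
    have h := hle (-f) 0 0 fun a b => by simpa using hf (a, b)
    simpa using h
  have heq : ∀ (g : C(K × K, ℝ)) (φ ψ : C(K, ℝ)), (∀ a b, g (a, b) = φ a + ψ b) →
      Λ g = ∫ a, φ a ∂μ + ∫ b, ψ b ∂ν := by
    intro g φ ψ h
    refine le_antisymm (hle g φ ψ fun a b => (h a b).le) ?_
    have h' := hle (-g) (-φ) (-ψ) fun a b => by
      simp only [ContinuousMap.neg_apply, h a b]; linarith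
    simp only [map_neg, ContinuousMap.neg_apply, integral_neg] at h'
    linarith
  have hfst : π.map Prod.fst = μ := by
    refine ext_of_forall_integral_eq_of_IsFiniteMeasure fun f => ?_
    rw [integral_map measurable_fst.aemeasurable f.continuous.aestronglyMeasurable]
    have h := heq (f.toContinuousMap.comp ContinuousMap.fst) f.toContinuousMap 0
      fun a b => by simp
    rw [← hπΛ] at h
    simpa using h
  have hsnd : π.map Prod.snd = ν := by
    refine ext_of_forall_integral_eq_of_IsFiniteMeasure fun f => ?_
    rw [integral_map measurable_snd.aemeasurable f.continuous.aestronglyMeasurable]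
    have h := heq (f.toContinuousMap.comp ContinuousMap.snd) 0 f.toContinuousMap
      fun a b => by simp
    rw [← hπΛ] at h
    simpa using h
  refine ⟨π, ?_, hfst, hsnd, fun g hg => ?_⟩
  · have : IsProbabilityMeasure (π.map Prod.fst) := by rw [hfst]; infer_instance
    exact Measure.isProbabilityMeasure_of_map Prod.fst
  · rw [hπΛ]
    refine hΛ g D ⟨0, 0, 1, one_pos, fun a b => ?_, by simp⟩
    simpa using hg (a, b)

/-- A lower semicontinuous function on a subspace of a metrizable space is the pointwise supremum
of an increasing sequence of nonnegative continuous functions on the ambient space. -/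
theorem LowerSemicontinuous.exists_monotone_continuousMap {X Y : Type*} [TopologicalSpace X]
    [TopologicalSpace Y] [TopologicalSpace.MetrizableSpace Y] [Nonempty X] {ι : X → Y}
    (hι : IsEmbedding ι) {ρ : X → ENNReal} (hρ : LowerSemicontinuous ρ) :
    ∃ c : ℕ → C(Y, ℝ), (∀ n y, 0 ≤ c n y) ∧ (∀ x, Monotone fun n => c n (ι x)) ∧
      ∀ x, ⨆ n, ENNReal.ofReal (c n (ι x)) = ρ x := by
  let := TopologicalSpace.metrizableSpaceMetric Y
  let F : ℕ → Y → X → ℝ := fun n y x => (min (ρ x) n).toReal + n * dist y (ι x)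
  have hF0 : ∀ n y x, 0 ≤ F n y x := fun n y x => by positivity
  have hbdd : ∀ n y, BddBelow (Set.range (F n y)) := fun n y =>
    ⟨0, by rintro _ ⟨x, rfl⟩; exact hF0 n y x⟩
  have hlip : ∀ n : ℕ, LipschitzWith n fun y => ⨅ x, F n y x := by
    intro n
    refine LipschitzWith.of_le_add_mul _ fun y z => ?_
    rw [← sub_le_iff_le_add]
    refine le_ciInf fun x => ?_
    rw [sub_le_iff_le_add]
    refine (ciInf_le (hbdd n y) x).trans ?_
    have h := mul_le_mul_of_nonneg_left (dist_triangle y z (ι x)) (Nat.cast_nonneg (α := ℝ) n)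
    simp only [F, NNReal.coe_natCast]
    linarith
  refine ⟨fun n => ⟨fun y => ⨅ x, F n y x, (hlip n).continuous⟩,
    fun n y => Real.iInf_nonneg (hF0 n y), fun x n m hnm => ?_, fun x => le_antisymm ?_ ?_⟩
  · refine ciInf_mono (hbdd n _) fun z => ?_
    have h1 : (min (ρ z) n).toReal ≤ (min (ρ z) m).toReal :=
      ENNReal.toReal_mono (min_lt_of_right_lt (ENNReal.natCast_lt_top m)).ne (by gcongr)
    simp only [F]
    gcongr
  · refine iSup_le fun n => ?_
    refine ENNReal.ofReal_le_of_le_toReal (b := min (ρ x) n) ?_ |>.trans (min_le_left _ _)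
    refine (ciInf_le (hbdd n _) x).trans ?_
    simp [F]
  · refine le_of_forall_lt fun r hr => ?_
    obtain ⟨s, hrs, hs⟩ := ENNReal.lt_iff_exists_nnreal_btwn.1 hr
    refine hrs.trans_le ?_
    obtain ⟨δ, hδ, hball⟩ : ∃ δ > 0, ∀ z, dist (ι x) (ι z) < δ → s < ρ z := by
      have h := hρ x s hs
      rw [hι.nhds_eq_comap] at h
      obtain ⟨δ, hδ, h'⟩ := (Metric.nhds_basis_ball.comap ι).eventually_iff.1 h
      exact ⟨δ, hδ, fun z hz => h' (by simpa [dist_comm] using hz)⟩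
    obtain ⟨n, hn⟩ := exists_nat_ge (max (s : ℝ) (s / δ))
    refine le_iSup_of_le n ?_
    rw [← ENNReal.ofReal_coe_nnreal]
    refine ENNReal.ofReal_le_ofReal (le_ciInf fun z => ?_)
    by_cases hz : dist (ι x) (ι z) < δ
    · have h1 : (s : ENNReal) ≤ min (ρ z) n :=
        le_min (hball z hz).le (by exact_mod_cast (le_max_left _ _).trans hn)
      have h2 := ENNReal.toReal_mono (min_lt_of_right_lt (ENNReal.natCast_lt_top n)).ne h1
      have h3 : (0 : ℝ) ≤ n * dist (ι x) (ι z) := by positivity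
      simp only [F]
      rw [ENNReal.coe_toReal] at h2
      linarith
    · have h1 : (s : ℝ) ≤ n * δ := (div_le_iff₀ hδ).1 ((le_max_right _ _).trans hn)
      have h2 : (n : ℝ) * δ ≤ n * dist (ι x) (ι z) := by gcongr; exact not_lt.1 hz
      have h3 : 0 ≤ (min (ρ z) n).toReal := ENNReal.toReal_nonneg
      simp only [F]
      linarith

/-- The nontrivial inequality of Kantorovich duality for a lower semicontinuous cost on a Polish
space. -/
theorem couplingCost_le_of_dual {E : Type*} [TopologicalSpace E] [PolishSpace E]
    [MeasurableSpace E] [BorelSpace E] {ρ : E × E → ENNReal} (hρ : LowerSemicontinuous ρ)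
    (μ ν : Measure E) [IsProbabilityMeasure μ] [IsProbabilityMeasure ν] (D : ℝ)
    (hdual : ∀ φ ψ : BoundedContinuousFunction E ℝ,
      (∀ a b, ENNReal.ofReal (φ a + ψ b) ≤ ρ (a, b)) → ∫ a, φ a ∂μ + ∫ b, ψ b ∂ν ≤ D) :
    couplingCost ρ μ ν ≤ ENNReal.ofReal D := by
  let := TopologicalSpace.upgradeIsCompletelyMetrizable E
  have : Nonempty E := nonempty_of_isProbabilityMeasure μ
  obtain ⟨e, he⟩ := Metric.PiNatEmbed.exists_embedding_to_hilbert_cube (X := E)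
  have hem : MeasurableEmbedding e := he.continuous.measurableEmbedding he.injective
  have hee : IsEmbedding (Prod.map e e) := he.prodMap he
  have heem : MeasurableEmbedding (Prod.map e e) :=
    hee.continuous.measurableEmbedding hee.injective
  have := Measure.isProbabilityMeasure_map (μ := μ) hem.measurable.aemeasurable
  have := Measure.isProbabilityMeasure_map (μ := ν) hem.measurable.aemeasurable
  obtain ⟨π, hπ, hfst, hsnd, hle⟩ := exists_coupling_integral_le (μ.map e) (ν.map e)
    (Function.extend (Prod.map e e) ρ ⊤) D fun φ ψ h => by
      rw [hem.integral_map, hem.integral_map]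
      refine hdual ((BoundedContinuousFunction.mkOfCompact φ).compContinuous ⟨e, he.continuous⟩)
        ((BoundedContinuousFunction.mkOfCompact ψ).compContinuous ⟨e, he.continuous⟩)
        fun a b => ?_
      have h1 := h (e a) (e b)
      rwa [show (e a, e b) = Prod.map e e (a, b) from rfl, hee.injective.extend_apply] at h1
  have hmap : (π.comap (Prod.map e e)).map (Prod.map e e) = π := by
    rw [heem.map_comap]
    refine Measure.restrict_eq_self_of_ae_mem ?_
    have h1 : ∀ᵐ p ∂π, p.1 ∈ Set.range e := by
      refine ae_of_ae_map (f := Prod.fst) (p := fun a => a ∈ Set.range e)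
        measurable_fst.aemeasurable ?_
      rw [hfst, hem.ae_map_iff]
      exact ae_of_all _ fun a => ⟨a, rfl⟩
    have h2 : ∀ᵐ p ∂π, p.2 ∈ Set.range e := by
      refine ae_of_ae_map (f := Prod.snd) (p := fun a => a ∈ Set.range e)
        measurable_snd.aemeasurable ?_
      rw [hsnd, hem.ae_map_iff]
      exact ae_of_all _ fun a => ⟨a, rfl⟩
    filter_upwards [h1, h2] with p hp1 hp2
    rw [Set.range_prodMap]
    exact ⟨hp1, hp2⟩
  set π' := π.comap (Prod.map e e)
  obtain ⟨c, hc0, hcmono, hcsup⟩ := hρ.exists_monotone_continuousMap hee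
  have hcoupling : IsProbabilityMeasure π' ∧ π'.map Prod.fst = μ ∧ π'.map Prod.snd = ν := by
    refine ⟨?_, hem.map_injective ?_, hem.map_injective ?_⟩
    · have : IsProbabilityMeasure (π'.map (Prod.map e e)) := by rw [hmap]; exact hπ
      exact Measure.isProbabilityMeasure_of_map (Prod.map e e)
    · rw [Measure.map_map hem.measurable measurable_fst, ← hfst, ← hmap,
        Measure.map_map measurable_fst heem.measurable]
      rfl
    · rw [Measure.map_map hem.measurable measurable_snd, ← hsnd, ← hmap,
        Measure.map_map measurable_snd heem.measurable]
      rfl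
  refine (iInf₂_le π' hcoupling).trans ?_
  simp_rw [← hcsup]
  rw [lintegral_iSup (f := fun n p => ENNReal.ofReal (c n (Prod.map e e p)))
    (fun n => ((c n).continuous.comp hee.continuous).measurable.ennreal_ofReal)
    fun n m hnm p => ENNReal.ofReal_le_ofReal (hcmono p hnm)]
  refine iSup_le fun n => ?_
  rw [← heem.lintegral_map (fun p => ENNReal.ofReal (c n p)), hmap,
    ← ofReal_integral_eq_lintegral_ofReal
      ((c n).continuous.integrable_of_hasCompactSupport (HasCompactSupport.of_compactSpace _))
      (ae_of_all _ (hc0 n))]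
  refine ENNReal.ofReal_le_ofReal (hle (c n) fun p => ?_)
  by_cases hp : ∃ q, Prod.map e e q = p
  · obtain ⟨q, rfl⟩ := hp
    rw [hee.injective.extend_apply, ← hcsup]
    exact le_iSup (fun n => ENNReal.ofReal (c n (Prod.map e e q))) n
  · rw [Function.extend_apply' _ _ _ hp]
    exact le_top

theorem integral_le_toReal_lintegral_ofReal {X : Type*} [MeasurableSpace X] {μ : Measure X}
    {f : X → ℝ} (hf : Integrable f μ) : ∫ x, f x ∂μ ≤ (∫⁻ x, ENNReal.ofReal (f x) ∂μ).toReal := by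
  rw [integral_eq_lintegral_pos_part_sub_lintegral_neg_part hf]
  exact sub_le_self _ ENNReal.toReal_nonneg

/-- The easy inequality of Kantorovich duality. -/
theorem ofReal_integral_add_integral_le_couplingCost {E : Type*} [TopologicalSpace E]
    [MeasurableSpace E] [BorelSpace E] (ρ : E × E → ENNReal) (μ ν : Measure E)
    (φ ψ : BoundedContinuousFunction E ℝ)
    (h : ∀ a b, ENNReal.ofReal (φ a + ψ b) ≤ ρ (a, b)) :
    ENNReal.ofReal (∫ a, φ a ∂μ + ∫ b, ψ b ∂ν) ≤ couplingCost ρ μ ν := by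
  refine le_iInf₂ fun π hπ => ?_
  obtain ⟨hprob, rfl, rfl⟩ := hπ
  have h1 : Integrable (fun p : E × E => φ p.1) π :=
    .of_bound (φ.continuous.measurable.comp measurable_fst).aestronglyMeasurable ‖φ‖
      (ae_of_all _ fun p => φ.norm_coe_le_norm p.1)
  have h2 : Integrable (fun p : E × E => ψ p.2) π :=
    .of_bound (ψ.continuous.measurable.comp measurable_snd).aestronglyMeasurable ‖ψ‖
      (ae_of_all _ fun p => ψ.norm_coe_le_norm p.2)
  rw [integral_map measurable_fst.aemeasurable φ.continuous.measurable.aestronglyMeasurable,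
    integral_map measurable_snd.aemeasurable ψ.continuous.measurable.aestronglyMeasurable,
    ← integral_add h1 h2]
  exact (ENNReal.ofReal_le_of_le_toReal (integral_le_toReal_lintegral_ofReal (h1.add h2))).trans
    (lintegral_mono fun p => h p.1 p.2)

/-- A Markov kernel which contracts the optimal coupling cost on Dirac masses contracts it on all
probability measures. -/
theorem couplingCost_bind_le {E : Type*} [TopologicalSpace E] [PolishSpace E]
    [MeasurableSpace E] [BorelSpace E] {ρ : E × E → ENNReal} (hρ : LowerSemicontinuous ρ)
    (κ : Kernel E E) [IsMarkovKernel κ]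
    (hκ : ∀ x y, couplingCost ρ (κ x) (κ y) ≤ ρ (x, y)) (μ ν : Measure E) :
    couplingCost ρ (μ.bind κ) (ν.bind κ) ≤ couplingCost ρ μ ν := by
  refine le_iInf₂ fun π hπ => ?_
  obtain ⟨hprob, rfl, rfl⟩ := hπ
  by_cases hD : ∫⁻ p, ρ p ∂π = ⊤
  · rw [hD]; exact le_top
  have := Measure.isProbabilityMeasure_map (μ := π) measurable_fst.aemeasurable
  have := Measure.isProbabilityMeasure_map (μ := π) measurable_snd.aemeasurable
  rw [← ENNReal.ofReal_toReal hD]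
  refine couplingCost_le_of_dual hρ _ _ _ fun φ ψ h => ?_
  have hmeas : ∀ f : BoundedContinuousFunction E ℝ, StronglyMeasurable fun x => ∫ z, f z ∂κ x :=
    fun f => StronglyMeasurable.integral_kernel
      f.continuous.measurable.stronglyMeasurable
  have hbound : ∀ (f : BoundedContinuousFunction E ℝ) x, ‖∫ z, f z ∂κ x‖ ≤ ‖f‖ := fun f x =>
    f.norm_integral_le_norm (μ := κ x)
  have hbind : ∀ (m : Measure E) [IsProbabilityMeasure m] (f : BoundedContinuousFunction E ℝ),
      ∫ z, f z ∂(m.bind κ) = ∫ x, ∫ z, f z ∂κ x ∂m := by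
    intro m _ f
    have e : m.bind κ = (κ ∘ₖ Kernel.const Unit m) () := by simp
    rw [e, Kernel.integral_comp (f.integrable _), Kernel.const_apply]
  have h1 : Integrable (fun p : E × E => ∫ z, φ z ∂κ p.1) π :=
    .of_bound ((hmeas φ).comp_measurable measurable_fst).aestronglyMeasurable ‖φ‖
      (ae_of_all _ fun p => hbound φ p.1)
  have h2 : Integrable (fun p : E × E => ∫ z, ψ z ∂κ p.2) π :=
    .of_bound ((hmeas ψ).comp_measurable measurable_snd).aestronglyMeasurable ‖ψ‖
      (ae_of_all _ fun p => hbound ψ p.2)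
  rw [hbind, hbind, integral_map measurable_fst.aemeasurable (hmeas φ).aestronglyMeasurable,
    integral_map measurable_snd.aemeasurable (hmeas ψ).aestronglyMeasurable, ← integral_add h1 h2]
  refine (integral_le_toReal_lintegral_ofReal (h1.add h2)).trans ?_
  refine ENNReal.toReal_mono hD (lintegral_mono fun p => ?_)
  exact (ofReal_integral_add_integral_le_couplingCost ρ _ _ φ ψ h).trans (hκ p.1 p.2)

theorem stmt_9 {E : Type*} [TopologicalSpace E] [PolishSpace E]
    [MeasurableSpace E] [BorelSpace E]
    (ρ : E × E → ENNReal) (hρ_lsc : LowerSemicontinuous ρ)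
    (hρ_eq : ∀ x y : E, ρ (x, y) = 0 ↔ x = y)
    (hρ_symm : ∀ x y : E, ρ (x, y) = ρ (y, x))
    (hρ_tri : ∀ x y z : E, ρ (x, y) ≤ ρ (x, z) + ρ (z, y))
    (κ : ℝ → Kernel E E)
    (hmk : ∀ t : ℝ, 0 ≤ t → IsMarkovKernel (κ t))
    (hsg : ∀ s t : ℝ, 0 ≤ s → 0 ≤ t → ∀ x : E, κ (t + s) x = (κ t x).bind (κ s))
    (hcontr : ∀ t : ℝ, 0 ≤ t → ∀ x y : E, couplingCost ρ (κ t x) (κ t y) ≤ ρ (x, y))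
    (hWmeas : ∀ x y : E, Measurable fun t : ℝ => couplingCost ρ (κ t x) (κ t y))
    (M : ℝ) (hM : 0 < M)
    (hcoup : ∀ x y : E,
      (∫⁻ t in Set.Ioi (0:ℝ), couplingCost ρ (κ t x) (κ t y)) ≤ ENNReal.ofReal M * ρ (x, y)) :
    ∀ α : ℝ, 1 < α → ∀ t : ℝ, M * α ≤ t → ∀ x y : E,
      couplingCost ρ (κ t x) (κ t y) ≤ ρ (x, y) / ENNReal.ofReal α := by
  intro α hα t ht x y
  have ht0 : 0 < t := (mul_pos hM (one_pos.trans hα)).trans_le ht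
  have hanti : ∀ s ∈ Set.Ioc 0 t,
      couplingCost ρ (κ t x) (κ t y) ≤ couplingCost ρ (κ s x) (κ s y) := by
    intro s hs
    have hts : 0 ≤ t - s := sub_nonneg.2 hs.2
    have := hmk (t - s) hts
    have h := couplingCost_bind_le hρ_lsc (κ (t - s)) (hcontr _ hts) (κ s x) (κ s y)
    rwa [← hsg _ _ hts hs.1.le, ← hsg _ _ hts hs.1.le, add_sub_cancel] at h
  have hint : ENNReal.ofReal t * couplingCost ρ (κ t x) (κ t y) ≤ ENNReal.ofReal M * ρ (x, y) :=
    calc ENNReal.ofReal t * couplingCost ρ (κ t x) (κ t y)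
        = ∫⁻ _ in Set.Ioc 0 t, couplingCost ρ (κ t x) (κ t y) := by
          rw [setLIntegral_const, Real.volume_Ioc, sub_zero, mul_comm]
      _ ≤ ∫⁻ s in Set.Ioc 0 t, couplingCost ρ (κ s x) (κ s y) :=
          setLIntegral_mono (hWmeas x y) hanti
      _ ≤ ∫⁻ s in Set.Ioi 0, couplingCost ρ (κ s x) (κ s y) :=
          lintegral_mono_set Set.Ioc_subset_Ioi_self
      _ ≤ _ := hcoup x y
  have hα0 : 0 < α := one_pos.trans hα
  rw [ENNReal.le_div_iff_mul_le (.inl (by simpa using hα0)) (.inl ENNReal.ofReal_ne_top)]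
  rw [← ENNReal.mul_le_mul_iff_right (a := ENNReal.ofReal M) (by simpa using hM)
    ENNReal.ofReal_ne_top]
  refine le_trans ?_ hint
  rw [mul_comm (couplingCost _ _ _), ← mul_assoc, ← ENNReal.ofReal_mul hM.le]
  gcongr
end
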